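/- (Correctness of Buchberger's algorithm / existence of finite Gröbner bases) Let K be a field, σ a finite type of indeterminates, and fix an admissible monomial order ≼ on σ →₀ ℕ. Then for every finite set F ⊆ MvPolynomial σ K there exists a finite set G ⊆ MvPolynomial σ K such that G is a Gröbner basis and Ideal.span G = Ideal.span F. -/

import Mathlib

open MvPolynomial Relation

/-- An admissible monomial order on `σ →₀ ℕ`: a linear order such that `0` is the
smallest element and which is compatible with addition. -/
structure AdmissibleOrder (σ : Type*) where
  le : (σ →₀ ℕ) → (σ →₀ ℕ) → Prop
  total : ∀ s t, le s t ∨ le t s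
  refl : ∀ t, le t t
  trans : ∀ s t u, le s t → le t u → le s u
  antisymm : ∀ s t, le s t → le t s → s = t
  zero_le : ∀ t, le 0 t
  add_right : ∀ s t u, le s t → le (s + u) (t + u)

namespace AdmissibleOrder

variable {σ : Type*} {K : Type*} [Field K]

/-- The strict part of an admissible order. -/
def lt (m : AdmissibleOrder σ) (s t : σ →₀ ℕ) : Prop := m.le s t ∧ s ≠ t

-- The leading monomial of a polynomial: the `m.le`-largest element of its support
-- (`0` for the zero polynomial).
open Classical in
noncomputable def lm (m : AdmissibleOrder σ) (p : MvPolynomial σ K) : σ →₀ ℕ :=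
  if h : ∃ v, v ∈ p.support ∧ ∀ u ∈ p.support, m.le u v then h.choose else 0

/-- The leading coefficient of a polynomial. -/
noncomputable def lc (m : AdmissibleOrder σ) (p : MvPolynomial σ K) : K :=
  coeff (m.lm p) p

/-- One-step polynomial reduction modulo a set `F`. -/
def Red (m : AdmissibleOrder σ) (F : Set (MvPolynomial σ K))
    (p q : MvPolynomial σ K) : Prop :=
  ∃ f ∈ F, f ≠ 0 ∧ ∃ t : σ →₀ ℕ,
    coeff (t + m.lm f) p ≠ 0 ∧
    q = p - (coeff (t + m.lm f) p / m.lc f) • (monomial t (1 : K)) * f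

/-- A set `G` is a Gröbner basis iff the reduction relation modulo `G` is confluent. -/
def IsGroebner (m : AdmissibleOrder σ) (G : Set (MvPolynomial σ K)) : Prop :=
  ∀ a b c : MvPolynomial σ K, ReflTransGen (m.Red G) a b → ReflTransGen (m.Red G) a c →
    ∃ d, ReflTransGen (m.Red G) b d ∧ ReflTransGen (m.Red G) c d

-- The S-polynomial of two polynomials.
open Classical in
noncomputable def spoly (m : AdmissibleOrder σ) (p q : MvPolynomial σ K) :
    MvPolynomial σ K :=
  if p = 0 ∨ q = 0 then 0 else
    (monomial (m.lm p ⊔ m.lm q - m.lm p) (1 / m.lc p)) * p -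
    (monomial (m.lm p ⊔ m.lm q - m.lm q) (1 / m.lc q)) * q

end AdmissibleOrder

namespace AdmissibleOrder

variable {σ : Type*} {K : Type*} [Field K] (m : AdmissibleOrder σ)

theorem le_of_le {s t : σ →₀ ℕ} (h : s ≤ t) : m.le s t := by
  have := m.add_right 0 (t - s) s (m.zero_le _)
  rwa [zero_add, tsub_add_cancel_of_le h] at this

theorem wellFounded_lt [Finite σ] : WellFounded m.lt := by
  have : IsPreorder (σ →₀ ℕ) m.le := { refl := m.refl, trans := m.trans }
  have hwqo : WellQuasiOrdered m.le := fun f ↦ by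
    obtain ⟨i, j, hij, h⟩ := wellQuasiOrdered_le f
    exact ⟨i, j, hij, m.le_of_le h⟩
  exact Subrelation.wf
    (fun {s t} h ↦ ⟨h.1, fun h' ↦ h.2 (m.antisymm s t h.1 h')⟩) hwqo.wellFounded

theorem exists_max (s : Finset (σ →₀ ℕ)) (hs : s.Nonempty) :
    ∃ v ∈ s, ∀ u ∈ s, m.le u v := by
  induction hs using Finset.Nonempty.cons_induction with
  | singleton a => exact ⟨a, by simp, by simp [m.refl]⟩
  | cons a s ha hs ih =>
    obtain ⟨v, hv, hmax⟩ := ih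
    rcases m.total a v with h | h
    · exact ⟨v, by simp [hv], by simpa [h] using hmax⟩
    · refine ⟨a, by simp, ?_⟩
      simpa [m.refl] using fun u hu ↦ m.trans u v a (hmax u hu) h

theorem lm_spec {p : MvPolynomial σ K} (hp : p ≠ 0) :
    m.lm p ∈ p.support ∧ ∀ u ∈ p.support, m.le u (m.lm p) := by
  have h : ∃ v, v ∈ p.support ∧ ∀ u ∈ p.support, m.le u v :=
    m.exists_max _ (MvPolynomial.support_nonempty.mpr hp)
  rw [lm, dif_pos h]
  exact h.choose_spec

theorem lc_ne_zero {p : MvPolynomial σ K} (hp : p ≠ 0) : m.lc p ≠ 0 :=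
  mem_support_iff.mp (m.lm_spec hp).1

/-- A monomial is reducible modulo `G` if the leading monomial of a nonzero element of `G`
divides it. -/
def Reducible (G : Set (MvPolynomial σ K)) (u : σ →₀ ℕ) : Prop :=
  ∃ g ∈ G, g ≠ 0 ∧ m.lm g ≤ u

variable {m} {G : Set (MvPolynomial σ K)}

theorem Red.sub_mem_span {p q : MvPolynomial σ K} (h : m.Red G p q) :
    p - q ∈ Ideal.span G := by
  obtain ⟨f, hf, -, t, -, rfl⟩ := h
  rw [sub_sub_cancel]
  exact Ideal.mul_mem_left _ _ (Ideal.subset_span hf)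

theorem sub_mem_span_of_reflTransGen {p q : MvPolynomial σ K}
    (h : ReflTransGen (m.Red G) p q) : p - q ∈ Ideal.span G := by
  induction h with
  | refl => simp
  | tail _ h ih => simpa using add_mem ih h.sub_mem_span

/-- Eliminating the largest reducible monomial `u` of `p` leaves only smaller ones. -/
theorem exists_red_of_max {p : MvPolynomial σ K} {u : σ →₀ ℕ} (hu : u ∈ p.support)
    (hr : m.Reducible G u) (hmax : ∀ v ∈ p.support, m.Reducible G v → m.le v u) :
    ∃ q, m.Red G p q ∧ ∀ v ∈ q.support, m.Reducible G v → m.lt v u := by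
  obtain ⟨g, hg, hg0, hle⟩ := hr
  have htu : u - m.lm g + m.lm g = u := tsub_add_cancel_of_le hle
  refine ⟨_, ⟨g, hg, hg0, u - m.lm g, ?_, rfl⟩, fun v hv hvr ↦ ?_⟩
  · rw [htu]
    exact mem_support_iff.mp hu
  · rw [htu, mem_support_iff, smul_monomial, coeff_sub, coeff_monomial_mul'] at hv
    constructor
    · by_cases hvp : v ∈ p.support
      · exact hmax v hvp hvr
      · rw [notMem_support_iff.mp hvp, zero_sub, neg_ne_zero] at hv
        have htv : u - m.lm g ≤ v := by
          by_contra h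
          simp [h] at hv
        rw [if_pos htv] at hv
        have := m.add_right _ _ (u - m.lm g) ((m.lm_spec hg0).2 (v - (u - m.lm g))
          (mem_support_iff.mpr (right_ne_zero_of_mul hv)))
        rwa [tsub_add_cancel_of_le htv, add_comm, htu] at this
    · rintro rfl
      apply hv
      rw [if_pos tsub_le_self, tsub_tsub_cancel_of_le hle]
      have := m.lc_ne_zero hg0
      change _ - _ * m.lc g = 0
      simp [this]

theorem exists_max_reducible {p : MvPolynomial σ K}
    (h : ∃ u ∈ p.support, m.Reducible G u) :
    ∃ u ∈ p.support, m.Reducible G u ∧ ∀ v ∈ p.support, m.Reducible G v → m.le v u := by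
  classical
  obtain ⟨u, hu, hmax⟩ := m.exists_max (p.support.filter (m.Reducible G))
    (by simpa [Finset.filter_nonempty_iff] using h)
  rw [Finset.mem_filter] at hu
  exact ⟨u, hu.1, hu.2, fun v hv hvr ↦ hmax v (Finset.mem_filter.mpr ⟨hv, hvr⟩)⟩

/-- Every polynomial reduces to one without reducible monomials. -/
theorem exists_normalForm [Finite σ] (m : AdmissibleOrder σ) (G : Set (MvPolynomial σ K))
    (p : MvPolynomial σ K) :
    ∃ q, ReflTransGen (m.Red G) p q ∧ ∀ u ∈ q.support, ¬ m.Reducible G u := by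
  by_cases h : ∃ u ∈ p.support, m.Reducible G u
  · obtain ⟨u, hu, hr, hmax⟩ := exists_max_reducible h
    induction u using m.wellFounded_lt.induction generalizing p with
    | _ u ih =>
      obtain ⟨q, hpq, hq⟩ := exists_red_of_max hu hr hmax
      by_cases h' : ∃ v ∈ q.support, m.Reducible G v
      · obtain ⟨v, hv, hvr, hvmax⟩ := exists_max_reducible h'
        obtain ⟨r, hqr, hr⟩ := ih v (hq v hv hvr) q h' hv hvr hvmax
        exact ⟨r, .head hpq hqr, hr⟩
      · exact ⟨q, .single hpq, by simpa using h'⟩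
  · exact ⟨p, .refl, by simpa using h⟩

/-- If the leading monomials of `G` divide those of all nonzero members of `Ideal.span G`,
then `G` is a Gröbner basis. -/
theorem isGroebner_of_reducible_lm [Finite σ]
    (h : ∀ p ∈ Ideal.span G, p ≠ 0 → m.Reducible G (m.lm p)) : m.IsGroebner G := by
  classical
  intro a b c hab hac
  obtain ⟨b', hb, hbn⟩ := exists_normalForm m G b
  obtain ⟨c', hc, hcn⟩ := exists_normalForm m G c
  suffices b' = c' from ⟨b', hb, this ▸ hc⟩
  by_contra hne
  have hmem : b' - c' ∈ Ideal.span G := by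
    simpa using sub_mem (sub_mem_span_of_reflTransGen (hac.trans hc))
      (sub_mem_span_of_reflTransGen (hab.trans hb))
  have hr := h _ hmem (sub_ne_zero.mpr hne)
  rcases Finset.mem_union.mp (support_sub σ _ _ (m.lm_spec (sub_ne_zero.mpr hne)).1) with hs | hs
  · exact hbn _ hs hr
  · exact hcn _ hs hr

theorem span_eq_of_reducible_lm [Finite σ] {I : Ideal (MvPolynomial σ K)} (hG : G ⊆ I)
    (h : ∀ p ∈ I, p ≠ 0 → m.Reducible G (m.lm p)) : Ideal.span G = I := by
  have hle : Ideal.span G ≤ I := Ideal.span_le.mpr hG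
  refine le_antisymm hle fun p hp ↦ ?_
  obtain ⟨q, hpq, hq⟩ := exists_normalForm m G p
  have hmem := sub_mem_span_of_reflTransGen hpq
  have hq0 : q = 0 := by
    by_contra hne
    have hqI : q ∈ I := by simpa using sub_mem hp (hle hmem)
    exact hq _ (m.lm_spec hne).1 (h q hqI hne)
  simpa [hq0] using hmem

theorem exists_finite_reducible_lm [Finite σ] (m : AdmissibleOrder σ)
    (I : Ideal (MvPolynomial σ K)) :
    ∃ G : Set (MvPolynomial σ K), G.Finite ∧ G ⊆ I ∧
      ∀ p ∈ I, p ≠ 0 → m.Reducible G (m.lm p) := by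
  set S : Set (σ →₀ ℕ) := m.lm '' {p | p ∈ I ∧ p ≠ 0}
  have hfin : {u | Minimal (· ∈ S) u}.Finite :=
    WellQuasiOrderedLE.finite_of_isAntichain (setOfPred_minimal_antichain _)
  obtain ⟨G, hGI, hGfin, hG⟩ :=
    (Set.exists_subset_image_finite_and (p := ({u | Minimal (· ∈ S) u} ⊆ ·))).mp
      ⟨_, fun _ hu ↦ hu.prop, hfin, subset_rfl⟩
  refine ⟨G, hGfin, fun p hp ↦ (hGI hp).1, fun p hp hp0 ↦ ?_⟩
  obtain ⟨u, hule, hu⟩ := exists_minimal_le_of_wellFoundedLT (· ∈ S) (m.lm p) ⟨p, ⟨hp, hp0⟩, rfl⟩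
  obtain ⟨g, hg, rfl⟩ : u ∈ m.lm '' G := hG hu
  exact ⟨g, hg, (hGI hg).2, hule⟩

end AdmissibleOrder

/-- Correctness of Buchberger's algorithm: every finite set of polynomials can be
completed to a finite Gröbner basis generating the same ideal. -/
theorem exists_finite_groebner_basis {σ K : Type*} [Fintype σ] [Field K]
    (m : AdmissibleOrder σ) (F : Set (MvPolynomial σ K)) (hF : F.Finite) :
    ∃ G : Set (MvPolynomial σ K),
      G.Finite ∧ m.IsGroebner G ∧ Ideal.span G = Ideal.span F := by
  obtain ⟨G, hfin, hGI, hG⟩ := m.exists_finite_reducible_lm (Ideal.span F)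
  have hspan := AdmissibleOrder.span_eq_of_reducible_lm hGI hG
  exact ⟨G, hfin, AdmissibleOrder.isGroebner_of_reducible_lm (hspan ▸ hG), hspan⟩
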